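/- Let H be a real Hilbert space and let K : H → H be a single-valued, continuous, α-strongly monotone operator with α > 0, and let M : H → 2^H be maximally monotone. Then for every z ∈ H there exists a unique p ∈ H such that K z − K p ∈ M p, i.e., the operator (K + M)^{-1} ∘ K is everywhere defined and single-valued. -/

import Mathlib

open scoped RealInnerProductSpace
open Filter Topology

/-- On a nonempty closed convex subset of `V × ℝ` on which `s + ‖w‖² / 2` is bounded below,
this function has a minimizer, stated through its variational inequality. -/
theorem exists_forall_add_inner_le_of_isClosed_convex {V : Type*} [NormedAddCommGroup V]
    [InnerProductSpace ℝ V] [CompleteSpace V] {E : Set (V × ℝ)} (hne : E.Nonempty)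
    (hcl : IsClosed E) (hconv : Convex ℝ E) {c : ℝ}
    (hbdd : ∀ e ∈ E, c ≤ e.2 + ‖e.1‖ ^ 2 / 2) :
    ∃ e ∈ E, ∀ f ∈ E, e.2 + ⟪e.1, e.1⟫ ≤ f.2 + ⟪e.1, f.1⟫ := by
  set g : V × ℝ → ℝ := fun e => e.2 + ‖e.1‖ ^ 2 / 2 with hg
  have hbdd' : BddBelow (g '' E) := ⟨c, by rintro _ ⟨e, he, rfl⟩; exact hbdd e he⟩
  set m := sInf (g '' E)
  have hmle : ∀ e ∈ E, m ≤ g e := fun e he => csInf_le hbdd' ⟨e, he, rfl⟩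
  have hex : ∀ n : ℕ, ∃ e ∈ E, g e < m + 1 / ((n : ℝ) + 1) := by
    intro n
    obtain ⟨_, ⟨e, he, rfl⟩, hlt⟩ := exists_lt_of_csInf_lt (hne.image g)
      (show sInf (g '' E) < m + 1 / ((n : ℝ) + 1) from lt_add_of_pos_right _ (by positivity))
    exact ⟨e, he, hlt⟩
  choose e heE hlt using hex
  have hlim := tendsto_one_div_add_atTop_nhds_zero_nat (𝕜 := ℝ)
  have hcauchy : CauchySeq fun n => (e n).1 := by
    refine cauchySeq_of_le_tendsto_0 (fun n : ℕ => √(8 * (1 / ((n : ℝ) + 1)))) ?_ ?_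
    · intro n k N hn hk
      rw [dist_eq_norm]
      apply Real.le_sqrt_of_sq_le
      have hmid := hmle _ (hconv (heE n) (heE k) (a := 1 / 2) (b := 1 / 2) (by norm_num)
        (by norm_num) (by norm_num))
      have h1 := hlt n
      have h2 := hlt k
      have h3 : 1 / ((n : ℝ) + 1) ≤ 1 / ((N : ℝ) + 1) := Nat.one_div_le_one_div hn
      have h4 : 1 / ((k : ℝ) + 1) ≤ 1 / ((N : ℝ) + 1) := Nat.one_div_le_one_div hk
      have hpar := parallelogram_law_with_norm ℝ (e n).1 (e k).1
      simp only [hg, Prod.fst_add, Prod.snd_add, Prod.smul_fst, Prod.smul_snd, smul_eq_mul,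
        ← smul_add, norm_smul, mul_pow] at hmid h1 h2
      norm_num at hmid
      linarith
    · simpa using (hlim.const_mul 8).sqrt
  obtain ⟨w, hw⟩ := cauchySeq_tendsto_of_complete hcauchy
  have hgm : Tendsto (fun n => g (e n)) atTop (𝓝 m) :=
    tendsto_of_tendsto_of_tendsto_of_le_of_le tendsto_const_nhds
      (by simpa using hlim.const_add m) (fun n => hmle _ (heE n)) (fun n => (hlt n).le)
  have hs : Tendsto (fun n => (e n).2) atTop (𝓝 (m - ‖w‖ ^ 2 / 2)) := by
    simpa [hg] using hgm.sub ((hw.norm.pow 2).div_const 2)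
  have hmem : (w, m - ‖w‖ ^ 2 / 2) ∈ E :=
    hcl.mem_of_tendsto (hw.prodMk_nhds hs) (Eventually.of_forall heE)
  refine ⟨_, hmem, fun f hf => ?_⟩
  have hineq : ∀ t ∈ Set.Ioc (0 : ℝ) 1,
      0 ≤ f.2 - (m - ‖w‖ ^ 2 / 2) + ⟪w, f.1 - w⟫ + t * (‖f.1 - w‖ ^ 2 / 2) := by
    rintro t ⟨ht0, ht1⟩
    have h := hmle _ (hconv.add_smul_sub_mem hmem hf ⟨ht0.le, ht1⟩)
    simp only [hg, Prod.fst_add, Prod.snd_add, Prod.smul_fst, Prod.smul_snd, Prod.fst_sub,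
      Prod.snd_sub, smul_eq_mul, norm_add_sq_real, norm_smul, mul_pow, inner_smul_right,
      Real.norm_eq_abs, sq_abs] at h
    refine le_of_mul_le_mul_left ?_ ht0
    nlinarith
  have hlim0 : Tendsto
      (fun t : ℝ => f.2 - (m - ‖w‖ ^ 2 / 2) + ⟪w, f.1 - w⟫ + t * (‖f.1 - w‖ ^ 2 / 2))
      (𝓝[>] 0) (𝓝 (f.2 - (m - ‖w‖ ^ 2 / 2) + ⟪w, f.1 - w⟫)) := by
    refine (Continuous.tendsto' (by fun_prop) 0 _ (by simp)).mono_left nhdsWithin_le_nhds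
  have := ge_of_tendsto hlim0
    (eventually_of_mem (Ioc_mem_nhdsGT (zero_lt_one' ℝ)) hineq)
  rw [inner_sub_right] at this
  dsimp only
  linarith

section MonotoneOperator

variable {H : Type*} [NormedAddCommGroup H] [InnerProductSpace ℝ H]

/-- Lipschitz estimate for the resolvent `x ↦ p` of an `a`-strongly monotone operator,
where `l⁻¹ • (x - p)` is a value of the operator at `p`. -/
theorem mul_norm_sub_le_of_strongly_monotone {a l : ℝ} (hl : 0 < l) {x y p q : H}
    (h : a * ‖p - q‖ ^ 2 ≤ ⟪p - q, l⁻¹ • (x - p) - l⁻¹ • (y - q)⟫) :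
    (1 + l * a) * ‖p - q‖ ≤ ‖x - y‖ := by
  rw [← smul_sub, real_inner_smul_right, sub_sub_sub_comm, inner_sub_right,
    real_inner_self_eq_norm_sq, inv_mul_eq_div, le_div_iff₀ hl] at h
  have hcs := real_inner_le_norm (p - q) (x - y)
  rcases (norm_nonneg (p - q)).eq_or_lt with h0 | h0
  · rw [← h0, mul_zero]; positivity
  · refine le_of_mul_le_mul_left ?_ h0
    nlinarith

/-- A set-valued operator that is monotone and has no proper monotone extension. -/
structure IsMaximallyMonotone (M : H → Set H) : Prop where
  inner_nonneg : ∀ x y x' y', x' ∈ M x → y' ∈ M y → 0 ≤ ⟪x - y, x' - y'⟫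
  mem_of_forall : ∀ x x', (∀ y y', y' ∈ M y → 0 ≤ ⟪x - y, x' - y'⟫) → x' ∈ M x

namespace IsMaximallyMonotone

variable {M : H → Set H}

theorem exists_mem (hM : IsMaximallyMonotone M) : ∃ y v, v ∈ M y := by
  by_contra! h
  exact h 0 0 (hM.mem_of_forall 0 0 fun y v hv => absurd hv (h y v))

/-- The Fitzpatrick function of a maximally monotone operator dominates the duality pairing. -/
theorem inner_le_of_forall_le (hM : IsMaximallyMonotone M) {x u : H} {s : ℝ}
    (h : ∀ y v, v ∈ M y → ⟪x, v⟫ + ⟪y, u⟫ - ⟪y, v⟫ ≤ s) : ⟪x, u⟫ ≤ s := by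
  by_contra! hlt
  have hmem : u ∈ M x := by
    refine hM.mem_of_forall x u fun y v hv => ?_
    have := h y v hv
    simp only [inner_sub_left, inner_sub_right]
    linarith
  linarith [h x u hmem]

theorem exists_neg_mem [CompleteSpace H] (hM : IsMaximallyMonotone M) : ∃ p, -p ∈ M p := by
  let E : Set (WithLp 2 (H × H) × ℝ) :=
    {e | ∀ y v, v ∈ M y → ⟪e.1.fst, v⟫ + ⟪y, e.1.snd⟫ - ⟪y, v⟫ ≤ e.2}
  have hgraph : ∀ y v, v ∈ M y → (WithLp.toLp 2 (y, v), ⟪y, v⟫) ∈ E := by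
    intro y v hv y' v' hv'
    have := hM.inner_nonneg y y' v v' hv hv'
    simp only [inner_sub_left, inner_sub_right] at this
    simp only [WithLp.toLp_fst, WithLp.toLp_snd]
    linarith
  have hne : E.Nonempty := by
    obtain ⟨y, v, hv⟩ := hM.exists_mem
    exact ⟨_, hgraph y v hv⟩
  have hcl : IsClosed E := by
    simp only [E, Set.ofPred_forall]
    refine isClosed_iInter fun y => isClosed_iInter fun v => isClosed_iInter fun _ =>
      isClosed_le ?_ (by fun_prop)
    have h1 : Continuous fun e : WithLp 2 (H × H) × ℝ => e.1.fst :=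
      (WithLp.continuous_fst 2 H H).comp continuous_fst
    have h2 : Continuous fun e : WithLp 2 (H × H) × ℝ => e.1.snd :=
      (WithLp.continuous_snd 2 H H).comp continuous_fst
    fun_prop
  have hconv : Convex ℝ E := by
    intro e he f hf a b ha hb hab y v hv
    have h1 := mul_le_mul_of_nonneg_left (he y v hv) ha
    have h2 := mul_le_mul_of_nonneg_left (hf y v hv) hb
    simp only [Prod.fst_add, Prod.snd_add, Prod.smul_fst, Prod.smul_snd, WithLp.add_fst,
      WithLp.add_snd, WithLp.smul_fst, WithLp.smul_snd, inner_add_left, inner_add_right,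
      real_inner_smul_left, real_inner_smul_right, smul_eq_mul]
    have h3 : ⟪y, v⟫ = a * ⟪y, v⟫ + b * ⟪y, v⟫ := by rw [← add_mul, hab, one_mul]
    linarith
  obtain ⟨⟨w, s⟩, he, hmin⟩ := exists_forall_add_inner_le_of_isClosed_convex hne hcl hconv
    (c := 0) (by
      rintro ⟨w, s⟩ he
      have h1 := hM.inner_le_of_forall_le he
      have h2 := norm_add_sq_real w.fst w.snd
      have h3 := WithLp.prod_norm_sq_eq_of_L2 w
      dsimp only at h1 ⊢
      nlinarith [sq_nonneg ‖w.fst + w.snd‖])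
  have hws : ⟪w.fst, w.snd⟫ ≤ s := hM.inner_le_of_forall_le he
  have key : ∀ y v, v ∈ M y → ‖w.fst + w.snd‖ ^ 2 ≤ ⟪y + w.snd, v + w.fst⟫ := by
    intro y v hv
    have h := hmin _ (hgraph y v hv)
    simp only [WithLp.prod_inner_apply, WithLp.ofLp_fst, WithLp.ofLp_snd,
      real_inner_self_eq_norm_sq] at h
    rw [norm_add_sq_real]
    simp only [inner_add_left, inner_add_right]
    rw [real_inner_comm w.fst w.snd, real_inner_comm w.fst y]
    linarith
  have hmem : -w.fst ∈ M (-w.snd) := by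
    refine hM.mem_of_forall _ _ fun y v hv => ?_
    have h := (sq_nonneg _).trans (key y v hv)
    rwa [← inner_neg_neg, neg_add_rev, neg_add_rev, ← sub_eq_add_neg, ← sub_eq_add_neg] at h
  have h0 := key _ _ hmem
  simp only [neg_add_cancel, inner_zero_left] at h0
  have h1 : w.fst + w.snd = 0 := by
    rw [← norm_eq_zero]
    exact pow_eq_zero_iff two_ne_zero |>.mp (le_antisymm h0 (sq_nonneg _))
  rw [eq_neg_of_add_eq_zero_left h1] at hmem
  exact ⟨-w.snd, hmem⟩

/-- **Minty's theorem**: the resolvent of a maximally monotone operator is everywhere defined. -/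
theorem exists_resolvent [CompleteSpace H] (hM : IsMaximallyMonotone M) {l : ℝ} (hl : 0 < l)
    (x : H) : ∃ p, l⁻¹ • (x - p) ∈ M p := by
  have hM' : IsMaximallyMonotone fun p => {v | l⁻¹ • (x + v) ∈ M p} := by
    constructor
    · intro y y' v v' hv hv'
      have h := hM.inner_nonneg _ _ _ _ hv hv'
      rw [← smul_sub, add_sub_add_left_eq_sub, real_inner_smul_right] at h
      exact nonneg_of_mul_nonneg_right h (inv_pos.mpr hl)
    · intro y v h
      refine hM.mem_of_forall _ _ fun y' v' hv' => ?_
      have h' := h y' (l • v' - x) (by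
        rwa [Set.mem_ofPred_eq, add_sub_cancel, inv_smul_smul₀ hl.ne'])
      have heq : v - (l • v' - x) = l • (l⁻¹ • (x + v) - v') := by
        rw [smul_sub, smul_inv_smul₀ hl.ne']; abel
      rw [heq, real_inner_smul_right] at h'
      exact nonneg_of_mul_nonneg_right h' hl
  obtain ⟨p, hp⟩ := hM'.exists_neg_mem
  exact ⟨p, by simpa [sub_eq_add_neg] using hp⟩

theorem of_continuous {K : H → H} (hK : Continuous K)
    (hmono : ∀ x y, 0 ≤ ⟪x - y, K x - K y⟫) : IsMaximallyMonotone fun x => {K x} := by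
  constructor
  · rintro x y _ _ rfl rfl
    exact hmono x y
  · intro x u h
    have hineq : ∀ t ∈ Set.Ioi (0 : ℝ), 0 ≤ ⟪K x - u, u - K (x - t • (K x - u))⟫ := by
      intro t ht
      have h' := h (x - t • (K x - u)) _ rfl
      rw [sub_sub_cancel, real_inner_smul_left] at h'
      exact nonneg_of_mul_nonneg_right h' ht
    have hlim : Tendsto (fun t : ℝ => ⟪K x - u, u - K (x - t • (K x - u))⟫) (𝓝[>] 0)
        (𝓝 ⟪K x - u, u - K x⟫) :=
      (Continuous.tendsto' (by fun_prop) 0 _ (by simp)).mono_left nhdsWithin_le_nhds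
    have h0 := ge_of_tendsto hlim (eventually_of_mem self_mem_nhdsWithin hineq)
    rw [← neg_sub (K x) u, inner_neg_right, real_inner_self_eq_norm_sq] at h0
    have : ‖K x - u‖ = 0 := by nlinarith [norm_nonneg (K x - u)]
    exact (sub_eq_zero.mp (norm_eq_zero.mp this)).symm

/-- Solvability of the inclusion in which `K` is replaced by its Yosida approximation. -/
theorem exists_yosida_solution [CompleteSpace H] (hM : IsMaximallyMonotone M) {K : H → H}
    (hK : Continuous K) {α : ℝ} (hα : 0 < α)
    (hstrong : ∀ x y, α * ‖x - y‖ ^ 2 ≤ ⟪x - y, K x - K y⟫) (z : H) {l : ℝ} (hl : 0 < l) :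
    ∃ q, z - K q ∈ M (q + l • K q) := by
  have hKmax := of_continuous hK fun x y => (by positivity : 0 ≤ α * ‖x - y‖ ^ 2).trans
    (hstrong x y)
  choose J hJ using fun x => hM.exists_resolvent hl x
  choose R hR using fun x => hKmax.exists_resolvent hl x
  simp only [Set.mem_singleton_iff] at hR
  have hJ1 : ∀ x y, ‖J x - J y‖ ≤ ‖x - y‖ := by
    intro x y
    have := mul_norm_sub_le_of_strongly_monotone (a := 0) hl
      (by simpa using hM.inner_nonneg _ _ _ _ (hJ x) (hJ y))
    simpa using this
  have hR1 : ∀ x y, (1 + l * α) * ‖R x - R y‖ ≤ ‖x - y‖ := by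
    intro x y
    refine mul_norm_sub_le_of_strongly_monotone hl ?_
    rw [hR, hR]
    exact hstrong _ _
  have hpos : 0 < 1 + l * α := by positivity
  have hcontr : ContractingWith (Real.toNNReal (1 + l * α)⁻¹) fun q => R (J (q + l • z)) := by
    constructor
    · rw [Real.toNNReal_lt_one]
      exact inv_lt_one_of_one_lt₀ (by nlinarith [mul_pos hl hα])
    · refine LipschitzWith.of_dist_le_mul fun x y => ?_
      rw [Real.coe_toNNReal _ (by positivity), dist_eq_norm, dist_eq_norm, inv_mul_eq_div,
        le_div_iff₀' hpos]
      refine (hR1 _ _).trans ((hJ1 _ _).trans ?_)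
      rw [add_sub_add_right_eq_sub]
  obtain ⟨q, hq⟩ : ∃ q, R (J (q + l • z)) = q := ⟨_, hcontr.fixedPoint_isFixedPt⟩
  have h1 := hR (J (q + l • z))
  rw [hq] at h1
  have h2 : q + l • K q = J (q + l • z) := by
    rw [← h1, smul_inv_smul₀ hl.ne', add_sub_cancel]
  refine ⟨q, ?_⟩
  have h3 := hJ (q + l • z)
  rw [← h2] at h3
  rwa [add_sub_add_left_eq_sub, ← smul_sub, inv_smul_smul₀ hl.ne'] at h3

/-- A priori bound for the values of `K` along solutions of the approximate inclusions. -/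
theorem exists_norm_le_of_yosida_solution (hM : IsMaximallyMonotone M) {K : H → H}
    (hK : Continuous K) {α : ℝ} (hα : 0 < α)
    (hstrong : ∀ x y, α * ‖x - y‖ ^ 2 ≤ ⟪x - y, K x - K y⟫) (z : H) :
    ∃ N, ∀ (l : ℝ) (q : H), 0 < l → l ≤ 1 → z - K q ∈ M (q + l • K q) → ‖K q‖ ≤ N := by
  obtain ⟨x, m, hm⟩ := hM.exists_mem
  obtain ⟨r, hr, hball⟩ := Metric.continuousAt_iff.mp (hK.continuousAt (x := x)) 1 one_pos
  set D := ‖z - m‖ with hD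
  set C := ‖K x‖ + 1
  set B := 1 + (D + ‖K x‖ + D ^ 2) / α
  refine ⟨(D * B + D ^ 2 + C * (B + r / 2)) / (r / 2), fun l q hl hl1 hq => ?_⟩
  have hD0 : 0 ≤ D := norm_nonneg _
  have hK0 : 0 ≤ ‖K x‖ := norm_nonneg _
  have hC0 : 0 ≤ C := by positivity
  have ht0 := norm_nonneg (q - x)
  have hk0 := norm_nonneg (K q)
  have hpair : ⟪q - x, K q⟫ ≤ D * ‖q - x‖ + D ^ 2 := by
    have h := hM.inner_nonneg _ _ _ _ hq hm
    rw [show q + l • K q - x = (q - x) + l • K q by abel,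
      show z - K q - m = (z - m) - K q by abel, inner_sub_right, inner_add_left, inner_add_left,
      real_inner_smul_left, real_inner_smul_left, real_inner_self_eq_norm_sq] at h
    have h1 := real_inner_le_norm (q - x) (z - m)
    have h2 := real_inner_le_norm (K q) (z - m)
    rw [← hD] at h1 h2
    have h3 : ⟪K q, z - m⟫ - ‖K q‖ ^ 2 ≤ D ^ 2 := by nlinarith [sq_nonneg (‖K q‖ - D)]
    have h4 := mul_le_mul_of_nonneg_left h3 hl.le
    nlinarith [sq_nonneg D]
  have hqB : ‖q - x‖ ≤ B := by
    have h := hstrong q x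
    have h1 := neg_le_of_abs_le (abs_real_inner_le_norm (q - x) (K x))
    rw [inner_sub_right] at h
    rcases le_total ‖q - x‖ 1 with h2 | h2
    · exact h2.trans (le_add_of_nonneg_right (by positivity))
    · have h3 : ‖q - x‖ ≤ (D + ‖K x‖ + D ^ 2) / α := by
        rw [le_div_iff₀' hα]
        refine le_of_mul_le_mul_right ?_ (zero_lt_one.trans_le h2)
        nlinarith [mul_le_mul_of_nonneg_left h2 (sq_nonneg D)]
      linarith
  rw [le_div_iff₀ (by positivity)]
  rcases hk0.eq_or_lt with h0 | h0
  · rw [← h0, zero_mul]; positivity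
  set v := (r / 2 / ‖K q‖) • K q with hv
  have hvn : ‖v‖ = r / 2 := by
    rw [hv, norm_smul, Real.norm_of_nonneg (by positivity), div_mul_cancel₀ _ h0.ne']
  have hKv : ‖K (x + v)‖ ≤ C := by
    have h := hball (x := x + v) (by rw [dist_self_add_left, hvn]; linarith)
    rw [dist_eq_norm] at h
    linarith [norm_sub_norm_le (K (x + v)) (K x)]
  have hvk : ⟪v, K q⟫ = ‖K q‖ * (r / 2) := by
    rw [hv, real_inner_smul_left, real_inner_self_eq_norm_sq]
    field_simp
  have hmono := (by positivity : 0 ≤ α * ‖q - (x + v)‖ ^ 2).trans (hstrong q (x + v))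
  rw [inner_sub_right, ← sub_sub, inner_sub_left (q - x) v (K q), hvk] at hmono
  have h1 := neg_le_of_abs_le (abs_real_inner_le_norm (q - x - v) (K (x + v)))
  have h2 : ‖q - x - v‖ ≤ B + r / 2 := by
    have := norm_sub_le (q - x) v
    linarith
  have h3 : ‖q - x - v‖ * ‖K (x + v)‖ ≤ (B + r / 2) * C :=
    mul_le_mul h2 hKv (norm_nonneg _) ((norm_nonneg _).trans h2)
  have h4 := mul_le_mul_of_nonneg_left hqB hD0
  linarith

theorem exists_sub_mem_of_strongly_monotone [CompleteSpace H] (hM : IsMaximallyMonotone M)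
    {K : H → H} (hK : Continuous K) {α : ℝ} (hα : 0 < α)
    (hstrong : ∀ x y, α * ‖x - y‖ ^ 2 ≤ ⟪x - y, K x - K y⟫) (z : H) :
    ∃ p, z - K p ∈ M p := by
  obtain ⟨N, hN⟩ := hM.exists_norm_le_of_yosida_solution hK hα hstrong z
  let l : ℕ → ℝ := fun n => 1 / ((n : ℝ) + 1)
  have hlpos : ∀ n, 0 < l n := fun n => Nat.one_div_pos_of_nat
  have hlanti : ∀ {n k : ℕ}, n ≤ k → l k ≤ l n := fun h => Nat.one_div_le_one_div h
  have hl1 : ∀ n, l n ≤ 1 := fun n => (hlanti n.zero_le).trans (by simp [l])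
  have hlim : Tendsto l atTop (𝓝 0) := tendsto_one_div_add_atTop_nhds_zero_nat
  choose q hq using fun n => hM.exists_yosida_solution hK hα hstrong z (hlpos n)
  have hqN : ∀ n, ‖K (q n)‖ ≤ N := fun n => hN _ _ (hlpos n) (hl1 n) (hq n)
  have hN0 : 0 ≤ N := (norm_nonneg _).trans (hqN 0)
  have hcauchy : CauchySeq q := by
    refine cauchySeq_of_le_tendsto_0 (fun n => √(4 * N ^ 2 / α * l n)) ?_ ?_
    · intro n k j hn hk
      rw [dist_eq_norm]
      apply Real.le_sqrt_of_sq_le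
      rw [div_mul_eq_mul_div, le_div_iff₀' hα]
      have h := hM.inner_nonneg _ _ _ _ (hq n) (hq k)
      rw [sub_sub_sub_cancel_left, ← neg_sub (K (q n)), inner_neg_right, add_sub_add_comm,
        inner_add_left] at h
      have h1 := neg_le_of_abs_le (abs_real_inner_le_norm
        (l n • K (q n) - l k • K (q k)) (K (q n) - K (q k)))
      have hbound : ∀ i, j ≤ i → ‖l i • K (q i)‖ ≤ l j * N := by
        intro i hi
        rw [norm_smul, Real.norm_of_nonneg (hlpos i).le]
        exact mul_le_mul (hlanti hi) (hqN i) (norm_nonneg _) (hlpos j).le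
      have h2 : ‖l n • K (q n) - l k • K (q k)‖ ≤ 2 * (l j * N) := by
        linarith [norm_sub_le (l n • K (q n)) (l k • K (q k)), hbound n hn, hbound k hk]
      have h3 : ‖K (q n) - K (q k)‖ ≤ 2 * N := by
        linarith [norm_sub_le (K (q n)) (K (q k)), hqN n, hqN k]
      have h4 := mul_le_mul h2 h3 (norm_nonneg _) ((norm_nonneg _).trans h2)
      linarith [hstrong (q n) (q k)]
    · simpa using (hlim.const_mul (4 * N ^ 2 / α)).sqrt
  obtain ⟨p, hp⟩ := cauchySeq_tendsto_of_complete hcauchy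
  have hKp : Tendsto (fun n => K (q n)) atTop (𝓝 (K p)) := (hK.tendsto p).comp hp
  have hpl : Tendsto (fun n => q n + l n • K (q n)) atTop (𝓝 p) := by
    simpa using hp.add (hlim.smul hKp)
  refine ⟨p, hM.mem_of_forall _ _ fun y v hv => ?_⟩
  exact ge_of_tendsto ((hpl.sub_const y).inner ((hKp.const_sub z).sub_const v))
    (Eventually.of_forall fun n => hM.inner_nonneg _ _ _ _ (hq n) hv)

end IsMaximallyMonotone

end MonotoneOperator

theorem stmt1 {H : Type*} [NormedAddCommGroup H] [InnerProductSpace ℝ H] [CompleteSpace H]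
    (K : H → H) (hKcont : Continuous K) (α : ℝ) (hα : 0 < α)
    (hstrong : ∀ x y, α * ‖x - y‖ ^ 2 ≤ ⟪x - y, K x - K y⟫)
    (M : H → Set H)
    (hMmono : ∀ x y x' y', x' ∈ M x → y' ∈ M y → 0 ≤ ⟪x - y, x' - y'⟫)
    (hMmax : ∀ x x', (∀ y y', y' ∈ M y → 0 ≤ ⟪x - y, x' - y'⟫) → x' ∈ M x) :
    ∀ z : H, ∃! p : H, K z - K p ∈ M p := by
  intro z
  obtain ⟨p, hp⟩ := IsMaximallyMonotone.exists_sub_mem_of_strongly_monotone ⟨hMmono, hMmax⟩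
    hKcont hα hstrong (K z)
  refine ⟨p, hp, fun q hq => ?_⟩
  have h := hMmono _ _ _ _ hq hp
  rw [sub_sub_sub_cancel_left, ← neg_sub (K q), inner_neg_right] at h
  have h1 : ‖q - p‖ ^ 2 ≤ 0 := by
    refine le_of_mul_le_mul_left ?_ hα
    linarith [hstrong q p]
  exact sub_eq_zero.mp (norm_eq_zero.mp (by nlinarith [norm_nonneg (q - p)]))
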